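/- Let ν be a finite complex Borel measure on [0,1) such that ∫₀¹ e^{2πinx} dν(x) = 0 for all integers n ≥ 0, and suppose ν is singular with respect to Lebesgue measure. Then ν = 0. -/

import Mathlib

open MeasureTheory

namespace Riesz


/-- A continuous functional on continuous functions killing all characters is zero. -/
lemma clm_zero (L : C(UnitAddCircle, ℂ) →L[ℂ] ℂ) (hL : ∀ n : ℤ, L (fourier n) = 0) : L = 0 := by
  have h1 : (Submodule.span ℂ (Set.range (@fourier 1))) ≤ L.ker := by
    rw [Submodule.span_le]
    rintro _ ⟨n, rfl⟩
    exact hL n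
  have h2 := Submodule.topologicalClosure_minimal _ h1 L.isClosed_ker
  rw [span_fourier_closure_eq_top] at h2
  ext φ
  exact h2 (Submodule.mem_top : φ ∈ _)

/-- Integration against a finite measure as a functional. -/
noncomputable def intL (μ : Measure UnitAddCircle) [IsFiniteMeasure μ] : C(UnitAddCircle, ℂ) →L[ℂ] ℂ :=
  LinearMap.mkContinuous
    { toFun := fun φ => ∫ x, φ x ∂μ
      map_add' := fun f g => integral_add
        (f.continuous.integrable_of_hasCompactSupport (HasCompactSupport.of_compactSpace f))
        (g.continuous.integrable_of_hasCompactSupport (HasCompactSupport.of_compactSpace g))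
      map_smul' := fun c f => integral_smul c f }
    (μ.real Set.univ) (fun f => by
      have := norm_integral_le_of_norm_le_const (μ := μ) (f := f) (C := ‖f‖)
        (Filter.Eventually.of_forall fun x => f.norm_coe_le_norm x)
      simpa [mul_comm] using this)

lemma intL_apply (μ : Measure UnitAddCircle) [IsFiniteMeasure μ] (φ : C(UnitAddCircle, ℂ)) :
    intL μ φ = ∫ x, φ x ∂μ := rfl

/-- A finite measure is determined by its Fourier coefficients. -/
lemma measure_ext (μ ν : Measure UnitAddCircle) [IsFiniteMeasure μ] [IsFiniteMeasure ν]
    (h : ∀ n : ℤ, ∫ x, fourier n x ∂μ = ∫ x, fourier n x ∂ν) : μ = ν := by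
  have h0 : intL μ - intL ν = 0 := clm_zero _ fun n => by
    simp only [sub_apply, intL_apply, h n, sub_self]
  refine ext_of_forall_integral_eq_of_IsFiniteMeasure fun f => ?_
  have h1 := DFunLike.congr_fun h0
    (⟨fun x => (f x : ℂ), by fun_prop⟩ : C(UnitAddCircle, ℂ))
  simp only [sub_apply, intL_apply, zero_apply,
    ContinuousMap.coe_mk, integral_complex_ofReal, sub_eq_zero] at h1
  exact_mod_cast h1

variable {σ : Measure UnitAddCircle} [IsFiniteMeasure σ]

/-- Characters as elements of `L²(σ)`. -/
noncomputable def e (σ : Measure UnitAddCircle) [IsFiniteMeasure σ] (n : ℤ) : Lp ℂ 2 σ :=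
  ContinuousMap.toLp 2 σ ℂ (fourier n)

lemma e_coe (n : ℤ) : e σ n =ᵐ[σ] fun x => fourier n x := ContinuousMap.coeFn_toLp σ _

lemma inner_e (n : ℤ) (w : Lp ℂ 2 σ) :
    inner ℂ (e σ n) w = ∫ x, fourier (-n) x * w x ∂σ := by
  rw [L2.inner_def]
  refine integral_congr_ae ?_
  filter_upwards [e_coe (σ := σ) n] with x hx
  rw [hx, fourier_neg, RCLike.inner_apply, mul_comm]

lemma norm_fourier (n : ℤ) (x : UnitAddCircle) : ‖fourier n x‖ = 1 := Circle.norm_coe _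

lemma memLp_mul (k : ℤ) (w : Lp ℂ 2 σ) : MemLp (fun x => fourier k x * w x) 2 σ := by
  refine (Lp.memLp w).of_le ((fourier k).continuous.aestronglyMeasurable.mul
    (Lp.aestronglyMeasurable w)) (Filter.Eventually.of_forall fun x => ?_)
  rw [norm_mul, norm_fourier, one_mul]

/-- Multiplication by a character. -/
noncomputable def mulF (k : ℤ) (w : Lp ℂ 2 σ) : Lp ℂ 2 σ := (memLp_mul k w).toLp _

lemma mulF_coe (k : ℤ) (w : Lp ℂ 2 σ) : mulF k w =ᵐ[σ] fun x => fourier k x * w x :=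
  MemLp.coeFn_toLp _

lemma inner_mulF (n k : ℤ) (w : Lp ℂ 2 σ) :
    inner ℂ (e σ n) (mulF k w) = inner ℂ (e σ (n - k)) w := by
  rw [inner_e, inner_e]
  refine integral_congr_ae ?_
  filter_upwards [mulF_coe k w] with x hx
  rw [hx, ← mul_assoc, ← fourier_add]
  congr 3
  ring

lemma key_norm (g : Lp ℂ 2 σ) (hσ : σ ⟂ₘ (volume : Measure UnitAddCircle))
    (hg : ∀ n : ℤ, n ≠ 0 → inner ℂ g (mulF n g) = 0) : g = 0 := by
  have hmeas : AEMeasurable (fun x => ‖g x‖₊ ^ 2) σ :=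
    ((Lp.aestronglyMeasurable g).nnnorm.aemeasurable.pow_const 2)
  have hfin : ∫⁻ x, ((‖g x‖₊ ^ 2 : NNReal) : ENNReal) ∂σ ≠ ⊤ := by
    have := (Lp.memLp g).eLpNorm_lt_top
    have h2 := lintegral_rpow_enorm_lt_top_of_eLpNorm_lt_top (by norm_num) (by norm_num) this
    simpa [enorm_eq_nnnorm] using h2.ne
  let ρ : Measure UnitAddCircle := σ.withDensity fun x => ((‖g x‖₊ ^ 2 : NNReal) : ENNReal)
  haveI : IsFiniteMeasure ρ := isFiniteMeasure_withDensity hfin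
  have hρ : ∀ n : ℤ, ∫ x, fourier n x ∂ρ = inner ℂ g (mulF n g) := by
    intro n
    rw [integral_withDensity_eq_integral_smul₀ hmeas, L2.inner_def]
    refine integral_congr_ae ?_
    filter_upwards [mulF_coe n g] with x hx
    rw [hx, RCLike.inner_apply, mul_assoc, RCLike.mul_conj, NNReal.smul_def]
    simp [mul_comm]
  have hvol : ∀ n : ℤ, n ≠ 0 → ∫ x : UnitAddCircle, fourier n x = 0 := by
    intro n hn
    exact integral_eq_zero_of_add_right_eq_neg (fourier_add_half_inv_index hn one_pos)
  have hEq : ρ = (ρ Set.univ) • (volume : Measure UnitAddCircle) := by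
    haveI : IsFiniteMeasure ((ρ Set.univ) • (volume : Measure UnitAddCircle)) :=
      Measure.smul_finite _ (measure_ne_top _ _)
    refine measure_ext _ _ fun n => ?_
    rw [integral_smul_measure]
    rcases eq_or_ne n 0 with rfl | hn
    · simp [Measure.real]
    · rw [hρ, hg n hn, hvol n hn, smul_zero]
  have hac : ρ ≪ (volume : Measure UnitAddCircle) := by
    rw [hEq]; exact Measure.smul_absolutelyContinuous
  have h0 : ρ = 0 := Measure.eq_zero_of_absolutelyContinuous_of_mutuallySingular hac
    (hσ.mono_ac (withDensity_absolutelyContinuous _ _) Measure.AbsolutelyContinuous.rfl)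
  rw [withDensity_eq_zero_iff (by exact hmeas.coe_nnreal_ennreal)] at h0
  rw [Lp.eq_zero_iff_ae_eq_zero]
  filter_upwards [h0] with x hx
  simpa using hx

lemma step (hσ : σ ⟂ₘ (volume : Measure UnitAddCircle)) (w : Lp ℂ 2 σ)
    (hw : ∀ n : ℤ, 1 ≤ n → inner ℂ (e σ n) w = 0) : inner ℂ (e σ 0) w = 0 := by
  let S : Submodule ℂ (Lp ℂ 2 σ) := Submodule.span ℂ (e σ '' {n | 1 ≤ n})
  have hperp : ∀ v : Lp ℂ 2 σ, (∀ n : ℤ, 1 ≤ n → inner ℂ (e σ n) v = 0) →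
      ∀ u ∈ S.topologicalClosure, inner ℂ v u = 0 := by
    intro v hv u hu
    have h1 : S ≤ (innerSL ℂ v).ker := by
      rw [Submodule.span_le]
      rintro _ ⟨n, hn, rfl⟩
      change inner ℂ v (e σ n) = 0
      rw [← inner_conj_symm, hv n hn, map_zero]
    exact Submodule.topologicalClosure_minimal _ h1 (innerSL ℂ v).isClosed_ker hu
  let K := S.topologicalClosure
  haveI : CompleteSpace K := (Submodule.isClosed_topologicalClosure S).completeSpace_coe
  obtain ⟨p, hp, g, hgK, hpg⟩ := Submodule.exists_add_mem_mem_orthogonal (K := K) (e σ 0)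
  have hge : ∀ n : ℤ, 1 ≤ n → inner ℂ (e σ n) g = 0 := fun n hn =>
    hgK _ (Submodule.le_topologicalClosure S (Submodule.subset_span ⟨n, hn, rfl⟩))
  have hgdef : g = e σ 0 - p := by rw [hpg]; simp
  have hneg : ∀ n : ℤ, 1 ≤ n → inner ℂ (mulF (-n) g) g = 0 := by
    intro n hn
    have hF : ∀ m : ℤ, 0 ≤ m → inner ℂ (e σ m) (mulF (-n) g) = 0 := by
      intro m hm
      rw [inner_mulF]
      exact hge _ (by lia)
    have h1 := hperp (mulF (-n) g) (fun m hm => hF m (by lia)) p hp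
    have h2 : inner ℂ (mulF (-n) g) (e σ 0) = 0 := by
      rw [← inner_conj_symm, hF 0 le_rfl, map_zero]
    have h3 : inner ℂ (mulF (-n) g) g = inner ℂ (mulF (-n) g) (e σ 0 - p) := by rw [← hgdef]
    rw [h3, inner_sub_right, h1, h2, sub_zero]
  have hflip : ∀ n : ℤ, inner ℂ (mulF (-n) g) g = inner ℂ g (mulF n g) := by
    intro n
    rw [L2.inner_def, L2.inner_def]
    refine integral_congr_ae ?_
    filter_upwards [mulF_coe n g, mulF_coe (-n) g] with x h1 h2
    rw [h1, h2, RCLike.inner_apply, RCLike.inner_apply, fourier_neg, map_mul, Complex.conj_conj]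
    ring
  have hg0 : g = 0 := by
    refine key_norm g hσ fun n hn => ?_
    rcases lt_or_gt_of_ne hn with h | h
    · have := hneg (-n) (by lia)
      rw [neg_neg] at this
      rw [← inner_conj_symm, this, map_zero]
    · rw [← hflip]
      exact hneg n (by lia)
  have : e σ 0 ∈ K := by rw [hpg, hg0, add_zero]; exact hp
  rw [← inner_conj_symm, hperp w hw _ this, map_zero]

lemma L2_zero (hσ : σ ⟂ₘ (volume : Measure UnitAddCircle)) (w : Lp ℂ 2 σ)
    (hw : ∀ n : ℤ, 0 ≤ n → inner ℂ (e σ n) w = 0) : w = 0 := by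
  have hk : ∀ k : ℕ, ∀ n : ℤ, -(k : ℤ) ≤ n → inner ℂ (e σ n) w = 0 := by
    intro k
    induction k with
    | zero => simpa using hw
    | succ k ih =>
      intro n hn
      by_cases h : -(k : ℤ) ≤ n
      · exact ih n h
      have hn' : n = 0 - ((k : ℤ) + 1) := by push_cast at hn; lia
      rw [hn', ← inner_mulF]
      refine step hσ _ fun m hm => ?_
      rw [inner_mulF]
      exact ih _ (by lia)
  have hall : ∀ n : ℤ, inner ℂ (e σ n) w = 0 := fun n => hk n.natAbs n (by lia)
  have hL : (innerSL ℂ w) ∘L (ContinuousMap.toLp 2 σ ℂ : C(UnitAddCircle, ℂ) →L[ℂ] Lp ℂ 2 σ) = 0 := by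
    refine clm_zero _ fun n => ?_
    change inner ℂ w (e σ n) = 0
    rw [← inner_conj_symm, hall, map_zero]
  have hd := ContinuousMap.toLp_denseRange ℂ σ ℂ (p := 2) (by norm_num)
  have hz : (innerSL ℂ w : Lp ℂ 2 σ → ℂ) = fun _ => 0 := by
    refine hd.equalizer (innerSL ℂ w).continuous continuous_const ?_
    ext φ
    exact DFunLike.congr_fun hL φ
  have := congrFun hz w
  exact inner_self_eq_zero.mp this

/-- The circle version. -/
lemma circle (τ : Measure UnitAddCircle) [IsFiniteMeasure τ] (hτ : τ ⟂ₘ (volume : Measure UnitAddCircle))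
    (h : UnitAddCircle → ℂ) (hm : Measurable h) (hint : Integrable h τ)
    (hcoef : ∀ n : ℕ, ∫ x, fourier (n : ℤ) x * h x ∂τ = 0) : h =ᵐ[τ] 0 := by
  let σ : Measure UnitAddCircle := τ.withDensity fun x => ((‖h x‖₊ : NNReal) : ENNReal)
  haveI : IsFiniteMeasure σ := isFiniteMeasure_withDensity hint.2.ne
  have hσ : σ ⟂ₘ (volume : Measure UnitAddCircle) :=
    hτ.mono_ac (withDensity_absolutelyContinuous _ _) Measure.AbsolutelyContinuous.rfl
  let u : UnitAddCircle → ℂ := fun x => (starRingEnd ℂ) (h x) / ‖h x‖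
  have hum : Measurable u := by
    have : Measurable fun x => (starRingEnd ℂ) (h x) :=
      Complex.continuous_conj.measurable.comp hm
    fun_prop
  have hu : MemLp u 2 σ := MemLp.of_bound hum.aestronglyMeasurable 1
    (Filter.Eventually.of_forall fun x => by simp [u, div_self_le_one])
  have hw : hu.toLp u = 0 := by
    refine L2_zero hσ _ fun n hn => ?_
    obtain ⟨m, rfl⟩ := Int.eq_ofNat_of_zero_le hn
    rw [inner_e]
    have h1 : ∫ x, fourier (-(m : ℤ)) x * hu.toLp u x ∂σ = ∫ x, fourier (-(m : ℤ)) x * u x ∂σ := by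
      refine integral_congr_ae ?_
      filter_upwards [hu.coeFn_toLp] with x hx
      rw [hx]
    rw [h1, integral_withDensity_eq_integral_smul hm.nnnorm]
    have h2 := congrArg (starRingEnd ℂ) (hcoef m)
    rw [← integral_conj, map_zero] at h2
    rw [← h2]
    refine integral_congr_ae (Filter.Eventually.of_forall fun x => ?_)
    simp only [u]
    rw [fourier_neg, map_mul, NNReal.smul_def, coe_nnnorm, Complex.real_smul]
    by_cases hx : h x = 0
    · simp [hx]
    · have : (‖h x‖ : ℂ) ≠ 0 := by simpa using hx
      field_simp
  have hu0 : u =ᵐ[σ] 0 := by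
    have := hu.coeFn_toLp
    rw [hw] at this
    exact this.symm.trans (Lp.coeFn_zero _ _ _)
  have hu1 := (ae_withDensity_iff hm.nnnorm.coe_nnreal_ennreal).1 hu0
  filter_upwards [hu1] with x hx
  by_contra hne
  have hne' : h x ≠ 0 := hne
  have := hx (by simpa using hne')
  simp [u, hne'] at this

end Riesz

/-- F. and M. Riesz + singularity: A finite complex Borel measure
`ν = h dτ` on `[0,1)` (written via a density `h ∈ L¹(τ)` with respect to a finite
positive measure `τ`, e.g. `τ = |ν|`) that is singular with respect to Lebesgue
measure and whose Fourier coefficients `∫ e^{2πinx} dν` vanish for all `n ≥ 0`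
is the zero measure, i.e. `h = 0` `τ`-a.e. -/
theorem stmt15 (τ : Measure ℝ) [IsFiniteMeasure τ]
    (hsing : τ ⟂ₘ (volume : Measure ℝ))
    (hsupp : τ (Set.Ico (0 : ℝ) 1)ᶜ = 0)
    (h : ℝ → ℂ) (hint : Integrable h τ)
    (hcoef : ∀ n : ℕ,
      ∫ x, Complex.exp (2 * Real.pi * Complex.I * n * x) * h x ∂τ = 0) :
    h =ᵐ[τ] 0 := by
  let q : ℝ → UnitAddCircle := fun x => (x : UnitAddCircle)
  have hq : Measurable q := AddCircle.measurable_mk'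
  let s : UnitAddCircle → ℝ := fun y => (AddCircle.measurableEquivIco 1 0 y : ℝ)
  have hs : Measurable s := measurable_subtype_coe.comp (AddCircle.measurableEquivIco 1 0).measurable
  have hIco : ∀ᵐ x ∂τ, x ∈ Set.Ico (0 : ℝ) 1 := hsupp
  have hsq : ∀ x ∈ Set.Ico (0 : ℝ) 1, s (q x) = x := fun x hx =>
    AddCircle.equivIco_coe_of_mem (p := (1 : ℝ)) (a := 0) (by simpa using hx)
  have hqs : ∀ y, q (s y) = y := fun y => AddCircle.coe_equivIco (p := (1 : ℝ)) (a := 0)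
  let h0 : ℝ → ℂ := hint.1.mk h
  have hh0 : h =ᵐ[τ] h0 := hint.1.ae_eq_mk
  have h0m : Measurable h0 := hint.1.stronglyMeasurable_mk.measurable
  have hcomp : (h0 ∘ s) ∘ q =ᵐ[τ] h := by
    filter_upwards [hIco, hh0] with x hx hx'
    simp only [Function.comp, hsq x hx, hx']
  have hmm : Measurable (h0 ∘ s) := h0m.comp hs
  have hS : τ.map q ⟂ₘ (volume : Measure UnitAddCircle) := by
    obtain ⟨A, hA, hA1, hA2⟩ := hsing
    refine ⟨s ⁻¹' A, hs hA, ?_, ?_⟩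
    · rw [Measure.map_apply hq (hs hA)]
      refine measure_mono_null (t := A ∪ (Set.Ico (0 : ℝ) 1)ᶜ) ?_ (measure_union_null hA1 hsupp)
      intro x hx
      by_cases hxI : x ∈ Set.Ico (0 : ℝ) 1
      · left
        have : s (q x) ∈ A := hx
        rwa [hsq x hxI] at this
      · right; exact hxI
    · rw [← (AddCircle.measurePreserving_mk 1 0).map_eq,
        Measure.map_apply hq (hs hA).compl]
      rw [Measure.restrict_apply (hq (hs hA).compl)]
      refine measure_mono_null (t := Aᶜ ∪ {1}) ?_ (measure_union_null hA2 (by simp))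
      rintro x ⟨hx, hx1⟩
      by_cases hx2 : x = 1
      · right; exact hx2
      left
      have : s (q x) ∉ A := hx
      rw [hsq x ⟨hx1.1.le, lt_of_le_of_ne (by simpa using hx1.2) hx2⟩] at this
      exact this
  have key := Riesz.circle (τ.map q) hS (h0 ∘ s) hmm
    ((integrable_map_measure hmm.aestronglyMeasurable hq.aemeasurable).2 (hint.congr hcomp.symm))
    (fun n => by
      refine (integral_map hq.aemeasurable
        ((fourier (n : ℤ)).continuous.aestronglyMeasurable.mul hmm.aestronglyMeasurable)).trans ?_
      rw [← hcoef n]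
      refine integral_congr_ae ?_
      filter_upwards [hcomp] with x hx
      change fourier (n : ℤ) (q x) * (h0 ∘ s) (q x) = _
      have hx' : (h0 ∘ s) (q x) = h x := hx
      rw [hx']
      simp only [q]
      rw [fourier_coe_apply]
      simp)
  have := ae_of_ae_map hq.aemeasurable key
  filter_upwards [this, hcomp] with x h1 h2
  rw [← h2]
  exact h1
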